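/- arXiv:1910.11858 — 2 statements merged into one kernel-verified Lean document; each statement's English description precedes it below -/
import Mathlib

section
/- For all integers r ≥ 2 and c ≥ 1, there exists an integer N such that for all n > N the following holds with k = n + c and a_ℓ := C(n−2, ℓ−1) · (2k/(n(n−1)))^ℓ for 1 ≤ ℓ ≤ n−1: (i) ∑_{ℓ=⌈log_r n⌉}^{n−1} a_ℓ < 1/n³, and (ii) a_1 > 1/n. -/
/-- If edges have probability at most `4 / n`, the expected number of paths of length `m + 1`
is at most `(4 / n) * 4 ^ m / m !`. -/
theorem choose_mul_pow_succ_le {n : ℕ} (hn : 0 < n) {p : ℝ} (hp₀ : 0 ≤ p) (hp : p ≤ 4 / n)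
    (m : ℕ) :
    ((n - 2).choose m : ℝ) * p ^ (m + 1) ≤ 4 / n * (4 ^ m / (m.factorial : ℝ)) := by
  have hn' : (0 : ℝ) < n := by exact_mod_cast hn
  have hchoose : ((n - 2).choose m : ℝ) ≤ (n : ℝ) ^ m / (m.factorial : ℝ) := by
    refine (Nat.choose_le_pow_div m (n - 2)).trans ?_
    gcongr
    exact Nat.sub_le n 2
  calc ((n - 2).choose m : ℝ) * p ^ (m + 1)
      ≤ (n : ℝ) ^ m / (m.factorial : ℝ) * (4 / n) ^ (m + 1) := by gcongr
    _ = 4 / n * (4 ^ m / (m.factorial : ℝ)) := by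
      rw [pow_succ, div_pow]
      field_simp

/-- A tail of the exponential series of `x`, starting where `n ≤ r ^ (m + 1)`, is at most
`(r / n) ^ 3 * exp (x * r ^ 3)`; the series is indexed by `ℓ = m + 1`. -/
theorem sum_Icc_pow_div_factorial_le {n L : ℕ} {r x : ℝ} (hn : 0 < n) (hx : 0 ≤ x) (hr : 0 ≤ r)
    (hL : 1 ≤ L) (h : ∀ ℓ, L ≤ ℓ → (n : ℝ) ≤ r ^ ℓ) (M : ℕ) :
    ∑ ℓ ∈ Finset.Icc L M, x ^ (ℓ - 1) / ((ℓ - 1).factorial : ℝ)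
      ≤ (r / n) ^ 3 * Real.exp (x * r ^ 3) := by
  have hn' : (0 : ℝ) < n := by exact_mod_cast hn
  calc ∑ ℓ ∈ Finset.Icc L M, x ^ (ℓ - 1) / ((ℓ - 1).factorial : ℝ)
      ≤ ∑ ℓ ∈ Finset.Icc L M,
          (r / n) ^ 3 * ((x * r ^ 3) ^ (ℓ - 1) / ((ℓ - 1).factorial : ℝ)) := by
        refine Finset.sum_le_sum fun ℓ hℓ => ?_
        have hLℓ := (Finset.mem_Icc.mp hℓ).1
        obtain ⟨m, rfl⟩ : ∃ m, ℓ = m + 1 := ⟨ℓ - 1, by omega⟩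
        have hone : 1 ≤ (r ^ (m + 1) / n) ^ 3 :=
          one_le_pow₀ ((one_le_div hn').mpr (h _ hLℓ))
        calc x ^ m / (m.factorial : ℝ)
            ≤ (r ^ (m + 1) / n) ^ 3 * (x ^ m / (m.factorial : ℝ)) :=
              le_mul_of_one_le_left (by positivity) hone
          _ = (r / n) ^ 3 * ((x * r ^ 3) ^ m / (m.factorial : ℝ)) := by ring
    _ = (r / n) ^ 3 *
          ∑ ℓ ∈ Finset.Icc L M, (x * r ^ 3) ^ (ℓ - 1) / ((ℓ - 1).factorial : ℝ) := by
        rw [Finset.mul_sum]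
    _ ≤ (r / n) ^ 3 * ∑ m ∈ Finset.range M, (x * r ^ 3) ^ m / (m.factorial : ℝ) := by
        gcongr
        calc ∑ ℓ ∈ Finset.Icc L M, (x * r ^ 3) ^ (ℓ - 1) / ((ℓ - 1).factorial : ℝ)
            ≤ ∑ ℓ ∈ Finset.Ico 1 (M + 1),
                (x * r ^ 3) ^ (ℓ - 1) / ((ℓ - 1).factorial : ℝ) := by
              refine Finset.sum_le_sum_of_subset_of_nonneg ?_ fun _ _ _ => by positivity
              intro ℓ hℓ
              simp only [Finset.mem_Icc, Finset.mem_Ico] at hℓ ⊢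
              omega
          _ = _ := by simp [Finset.sum_Ico_eq_sum_range]
    _ ≤ (r / n) ^ 3 * Real.exp (x * r ^ 3) := by
        gcongr
        exact Real.sum_le_exp_of_nonneg (by positivity) M


/-- For all integers `r ≥ 2` and `c ≥ 1`, there is `N` such that for all `n > N`, with
`k = n + c` and `a_ℓ = C(n-2, ℓ-1) (2k/(n(n-1)))^ℓ` (the expected number of paths of
length `ℓ` from node `1` to node `n`): (i) `∑_{ℓ = ⌈log_r n⌉}^{n-1} a_ℓ < 1/n³`, and
(ii) `a_1 > 1/n`. -/
theorem expected_paths_sum_bounds (r c : ℕ) (hr : 2 ≤ r) (hc : 1 ≤ c) :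
    ∃ N : ℕ, ∀ n : ℕ, N < n →
      (∑ ℓ ∈ Finset.Icc ⌈Real.logb r n⌉₊ (n - 1),
          ((n - 2).choose (ℓ - 1) : ℝ) *
            (2 * ((n : ℝ) + c) / ((n : ℝ) * ((n : ℝ) - 1))) ^ ℓ)
        < 1 / (n : ℝ) ^ 3 ∧
      ((n - 2).choose (1 - 1) : ℝ) * (2 * ((n : ℝ) + c) / ((n : ℝ) * ((n : ℝ) - 1))) ^ 1
        > 1 / (n : ℝ) := by
  obtain ⟨B, hB⟩ := exists_nat_gt (4 * (r : ℝ) ^ 3 * Real.exp (4 * (r : ℝ) ^ 3))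
  refine ⟨B + c + 2, fun n hn => ?_⟩
  have hnR : (B : ℝ) + c + 2 < n := by exact_mod_cast hn
  have hB₀ : (0 : ℝ) ≤ B := B.cast_nonneg
  have hc₀ : (0 : ℝ) ≤ c := c.cast_nonneg
  have hn₀ : (0 : ℝ) < n := by linarith
  have hn₁ : (0 : ℝ) < (n : ℝ) - 1 := by linarith
  have hr₁ : (1 : ℝ) < r := by exact_mod_cast hr
  set p : ℝ := 2 * ((n : ℝ) + c) / ((n : ℝ) * ((n : ℝ) - 1)) with hp
  have hp₀ : 0 ≤ p := by positivity
  have hp₄ : p ≤ 4 / n := by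
    rw [hp, div_le_div_iff₀ (by positivity) hn₀]
    nlinarith
  have hL : 1 ≤ ⌈Real.logb r n⌉₊ :=
    Nat.ceil_pos.mpr (Real.logb_pos hr₁ (by linarith))
  have hpow : ∀ ℓ, ⌈Real.logb r n⌉₊ ≤ ℓ → (n : ℝ) ≤ (r : ℝ) ^ ℓ := fun ℓ hℓ => by
    rw [← Real.rpow_natCast, ← Real.logb_le_iff_le_rpow hr₁ hn₀]
    exact Nat.ceil_le.mp hℓ
  constructor
  · calc ∑ ℓ ∈ Finset.Icc ⌈Real.logb r n⌉₊ (n - 1), ((n - 2).choose (ℓ - 1) : ℝ) * p ^ ℓ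
        ≤ ∑ ℓ ∈ Finset.Icc ⌈Real.logb r n⌉₊ (n - 1),
            4 / (n : ℝ) * (4 ^ (ℓ - 1) / ((ℓ - 1).factorial : ℝ)) := by
          refine Finset.sum_le_sum fun ℓ hℓ => ?_
          have hLℓ := (Finset.mem_Icc.mp hℓ).1
          have key := choose_mul_pow_succ_le (by omega : 0 < n) hp₀ hp₄ (ℓ - 1)
          rwa [Nat.sub_add_cancel (hL.trans hLℓ)] at key
      _ ≤ 4 / (n : ℝ) * ((r / n) ^ 3 * Real.exp (4 * (r : ℝ) ^ 3)) := by
          rw [← Finset.mul_sum]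
          gcongr
          exact sum_Icc_pow_div_factorial_le (by omega) (by norm_num) (by linarith) hL hpow _
      _ = 4 * (r : ℝ) ^ 3 * Real.exp (4 * (r : ℝ) ^ 3) / n * (1 / (n : ℝ) ^ 3) := by ring
      _ < 1 / (n : ℝ) ^ 3 := by
          refine mul_lt_of_lt_one_left (by positivity) ?_
          rw [div_lt_one hn₀]
          linarith
  · simp only [Nat.sub_self, Nat.choose_zero_right, Nat.cast_one, one_mul, pow_one, gt_iff_lt]
    rw [hp, div_lt_div_iff₀ hn₀ (by positivity)]
    nlinarith
end

section
/- Let n ≥ 3 and k ≥ 1 be integers with k ≤ 2(n−1), and let ℓ be an integer with 2 ≤ ℓ ≤ n−1. Then C(n−2, ℓ−1) · (2k/(n(n−1)))^ℓ ≤ (4/n) · (4e/(ℓ−1))^{ℓ−1}, where e is Euler's number. -/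
theorem Nat.cast_choose_le_exp_mul_div_pow (N m : ℕ) (hm : 0 < m) :
    (N.choose m : ℝ) ≤ (Real.exp 1 * N / m) ^ m := by
  have hm' : (0 : ℝ) < m := by exact_mod_cast hm
  have hexp := Real.pow_div_factorial_le_exp _ hm'.le m
  calc (N.choose m : ℝ) ≤ (N : ℝ) ^ m / m.factorial := Nat.choose_le_pow_div m N
    _ = ((N : ℝ) / m) ^ m * ((m : ℝ) ^ m / m.factorial) := by
        rw [div_pow]; field_simp
    _ ≤ ((N : ℝ) / m) ^ m * Real.exp m := by gcongr
    _ = (Real.exp 1 * N / m) ^ m := by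
        rw [mul_div_assoc, mul_pow, ← Real.exp_nat_mul, mul_one, mul_comm]

/-- Let `n ≥ 3` and `k ≥ 1` be integers with `k ≤ 2(n-1)`, and let `2 ≤ ℓ ≤ n-1`.  Then
`C(n-2, ℓ-1) · (2k/(n(n-1)))^ℓ ≤ (4/n) · (4e/(ℓ-1))^(ℓ-1)`, where `e` is Euler's
number. -/
theorem expected_paths_term_bound (n k ℓ : ℕ) (hn : 3 ≤ n) (hk1 : 1 ≤ k)
    (hk : k ≤ 2 * (n - 1)) (hℓ : 2 ≤ ℓ) (hℓn : ℓ ≤ n - 1) :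
    ((n - 2).choose (ℓ - 1) : ℝ) * (2 * (k : ℝ) / ((n : ℝ) * ((n : ℝ) - 1))) ^ ℓ
      ≤ (4 / (n : ℝ)) * (4 * Real.exp 1 / ((ℓ : ℝ) - 1)) ^ (ℓ - 1) := by
  obtain ⟨m, rfl⟩ : ∃ m, ℓ = m + 1 := ⟨ℓ - 1, by omega⟩
  have hm : 0 < m := by omega
  have hn' : (3 : ℝ) ≤ n := by exact_mod_cast hn
  have hn1 : (0 : ℝ) < (n : ℝ) - 1 := by linarith
  have hk' : (k : ℝ) ≤ 2 * ((n : ℝ) - 1) := by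
    have h : (k : ℝ) ≤ ((2 * (n - 1) : ℕ) : ℝ) := by exact_mod_cast hk
    simpa [Nat.cast_sub (show 1 ≤ n by omega)] using h
  have hp : 2 * (k : ℝ) / ((n : ℝ) * ((n : ℝ) - 1)) ≤ 4 / n := by
    rw [div_le_div_iff₀ (by positivity) (by positivity)]
    nlinarith
  have hchoose := Nat.cast_choose_le_exp_mul_div_pow n m hm
  have hmono : ((n - 2).choose m : ℝ) ≤ n.choose m := by
    exact_mod_cast Nat.choose_le_choose m (Nat.sub_le n 2)
  simp only [Nat.add_sub_cancel, Nat.cast_add, Nat.cast_one, add_sub_cancel_right]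
  calc ((n - 2).choose m : ℝ) * (2 * (k : ℝ) / ((n : ℝ) * ((n : ℝ) - 1))) ^ (m + 1)
      ≤ (Real.exp 1 * n / m) ^ m * (4 / n) ^ (m + 1) := by
        gcongr
        exact hmono.trans hchoose
    _ = 4 / n * (Real.exp 1 * n / m * (4 / n)) ^ m := by rw [mul_pow]; ring
    _ = 4 / n * (4 * Real.exp 1 / m) ^ m := by
        congr 2
        field_simp
end
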